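/- Let n ≥ 2 and let g : ℝⁿ → ℝ be a positive definite radial kernel which is moreover C¹. Let B = {x ∈ ℝⁿ : ‖x‖ < R} be the open ball of radius R > 0 centered at 0 and suppose F[B] = 0. Let V : ℝⁿ → ℝⁿ be a C¹ vector field admitting a global flow T, and write B_t = T(t,·)(B). Then B is a critical point of F along the flow: the function t ↦ F[B_t] is differentiable at t = 0 with derivative equal to 0. -/

import Mathlib

open MeasureTheory Metric
open scoped RealInnerProductSpace

/-- `g` is a positive definite radial kernel: continuous, depends only on the norm, and
for every smooth compactly supported complex test function `μ` the integral
`∬ g(x−y) μ(x) conj(μ(y))` is real and nonnegative. -/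
def IsPosDefRadialKernel {n : ℕ} (g : EuclideanSpace ℝ (Fin n) → ℝ) : Prop :=
  Continuous g ∧
  (∀ x y, ‖x‖ = ‖y‖ → g x = g y) ∧
  ∀ μ : EuclideanSpace ℝ (Fin n) → ℂ, ContDiff ℝ (⊤ : ℕ∞) μ → HasCompactSupport μ →
    (∫ x, ∫ y, (g (x - y) : ℂ) * μ x * (starRingEnd ℂ) (μ y)).im = 0 ∧
    0 ≤ (∫ x, ∫ y, (g (x - y) : ℂ) * μ x * (starRingEnd ℂ) (μ y)).re

/-- `T` is a global flow of the vector field `V`. -/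
def IsGlobalFlow {n : ℕ} (V : EuclideanSpace ℝ (Fin n) → EuclideanSpace ℝ (Fin n))
    (T : ℝ → EuclideanSpace ℝ (Fin n) → EuclideanSpace ℝ (Fin n)) : Prop :=
  (∀ x, T 0 x = x) ∧ ∀ t x, HasDerivAt (fun s => T s x) (V (T t x)) t

/-- Displacement bound, forward time. -/
lemma aux_disp {E : Type*} [NormedAddCommGroup E] [NormedSpace ℝ E] {W : E → E} {γ : ℝ → E}
    (hγ : ∀ t, HasDerivAt γ (W (γ t)) t) {R M : ℝ} (hM : 0 < M)
    (hW : ∀ x, ‖x‖ ≤ R + 1 → ‖W x‖ < M) (h0 : ‖γ 0‖ ≤ R) {t : ℝ} (ht : 0 ≤ t)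
    (htM : M * t ≤ 1) : ‖γ t - γ 0‖ ≤ M * t := by
  refine image_norm_le_of_norm_deriv_right_lt_deriv_boundary (a := 0) (b := t)
    (f := fun s => γ s - γ 0) (f' := fun s => W (γ s)) (B := fun s => M * s) (B' := fun _ => M)
    ?_ ?_ ?_ ?_ ?_ ⟨ht, le_rfl⟩
  · intro s _
    exact ((hγ s).sub_const _).continuousAt.continuousWithinAt
  · intro s _
    exact ((hγ s).sub_const _).hasDerivWithinAt
  · simp
  · intro s
    simpa using (hasDerivAt_id s).const_mul M
  · intro s hs h
    apply hW
    have h1 : M * s ≤ M * t := by gcongr; exact hs.2.le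
    have h2 : ‖γ s‖ ≤ ‖γ s - γ 0‖ + ‖γ 0‖ := norm_le_norm_sub_add _ _
    linarith

lemma aux_disp' {E : Type*} [NormedAddCommGroup E] [NormedSpace ℝ E] {W : E → E} {γ : ℝ → E}
    (hγ : ∀ t, HasDerivAt γ (W (γ t)) t) {R M : ℝ} (hM : 0 < M)
    (hW : ∀ x, ‖x‖ ≤ R + 1 → ‖W x‖ < M) (h0 : ‖γ 0‖ ≤ R) {t : ℝ}
    (htM : M * |t| ≤ 1) : ‖γ t - γ 0‖ ≤ M * |t| := by
  rcases le_total 0 t with ht | ht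
  · rw [abs_of_nonneg ht] at *
    exact aux_disp hγ hM hW h0 ht htM
  · rw [abs_of_nonpos ht] at *
    have hγ' : ∀ s, HasDerivAt (fun s => γ (-s)) ((fun x => - W x) (γ (-s))) s := by
      intro s
      simpa [Function.comp_def] using (hγ (-s)).scomp s (hasDerivAt_neg s)
    have := aux_disp (W := fun x => - W x) (γ := fun s => γ (-s)) hγ' hM (R := R) (by simpa using hW) (by simpa using h0)
      (t := -t) (by linarith) htM
    simpa using this

lemma aux_unique {E : Type*} [NormedAddCommGroup E] [NormedSpace ℝ E] [ProperSpace E]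
    {W : E → E} (hW : ContDiff ℝ 1 W) {γ δ : ℝ → E}
    (hγ : ∀ t, HasDerivAt γ (W (γ t)) t) (hδ : ∀ t, HasDerivAt δ (W (δ t)) t)
    (h0 : γ 0 = δ 0) (t : ℝ) : γ t = δ t := by
  have cγ : Continuous γ := continuous_iff_continuousAt.2 fun s => (hγ s).continuousAt
  have cδ : Continuous δ := continuous_iff_continuousAt.2 fun s => (hδ s).continuousAt
  obtain ⟨A, hA⟩ := (isCompact_Icc (a := -|t|-1) (b := |t|+1)).exists_bound_of_continuousOn
    cγ.continuousOn
  obtain ⟨B, hB⟩ := (isCompact_Icc (a := -|t|-1) (b := |t|+1)).exists_bound_of_continuousOn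
    cδ.continuousOn
  obtain ⟨L, hL⟩ := (isCompact_closedBall (0 : E) (max A B)).exists_bound_of_continuousOn
    (hW.continuous_fderiv one_ne_zero).continuousOn
  have hLip : LipschitzOnWith L.toNNReal W (closedBall (0 : E) (max A B)) := by
    refine Convex.lipschitzOnWith_of_nnnorm_fderiv_le (𝕜 := ℝ)
      (fun x _ => (hW.differentiable one_ne_zero) x) ?_ (convex_closedBall _ _)
    intro x hx
    rw [← NNReal.coe_le_coe, coe_nnnorm]
    exact (hL x hx).trans (Real.le_coe_toNNReal _)
  have := ODE_solution_unique_of_mem_Ioo (v := fun _ => W) (K := L.toNNReal)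
    (s := fun _ => closedBall (0 : E) (max A B)) (f := γ) (g := δ) (a := -|t|-1) (b := |t|+1)
    (t₀ := 0) (fun _ _ => hLip) (by constructor <;> linarith [abs_nonneg t])
    (fun s hs => ⟨hγ s, by
      simpa using Or.inl (hA s (Set.Ioo_subset_Icc_self hs))⟩)
    (fun s hs => ⟨hδ s, by
      simpa using Or.inr (hB s (Set.Ioo_subset_Icc_self hs))⟩) h0
  exact this ⟨by linarith [neg_abs_le t], by linarith [le_abs_self t]⟩

lemma aux_flow {n : ℕ} {V : EuclideanSpace ℝ (Fin n) → EuclideanSpace ℝ (Fin n)}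
    {T : ℝ → EuclideanSpace ℝ (Fin n) → EuclideanSpace ℝ (Fin n)}
    (hV : ContDiff ℝ 1 V) (hT : IsGlobalFlow V T) (R : ℝ) :
    ∃ M : ℝ, 0 < M ∧ ∀ t : ℝ, M * |t| ≤ 1 →
      T t '' ball 0 R ⊆ ball 0 (R + M * |t|) ∧ ball 0 (R - M * |t|) ⊆ T t '' ball 0 R := by
  obtain ⟨L, hL⟩ := (isCompact_closedBall (0 : EuclideanSpace ℝ (Fin n))
    (R + 1)).exists_bound_of_continuousOn hV.continuous.continuousOn
  have hM : 0 < max L 0 + 1 := by positivity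
  have hW : ∀ x, ‖x‖ ≤ R + 1 → ‖V x‖ < max L 0 + 1 := fun x hx =>
    (hL x (by simpa using hx)).trans_lt ((le_max_left _ _).trans_lt (lt_add_one _))
  refine ⟨max L 0 + 1, hM, fun t ht => ?_⟩
  generalize max L 0 + 1 = M at *
  have key : ∀ s x, |s| = |t| → ‖x‖ ≤ R → ‖T s x - x‖ ≤ M * |t| := by
    intro s x hs hx
    have := aux_disp' (γ := fun s => T s x) (fun s => hT.2 s x) hM hW
      (by simpa [hT.1] using hx) (t := s) (by rwa [hs])
    simpa [hT.1, hs] using this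
  constructor
  · rintro _ ⟨x, hx, rfl⟩
    rw [mem_ball_zero_iff] at *
    have := key t x rfl hx.le
    have h2 : ‖T t x‖ ≤ ‖T t x - x‖ + ‖x‖ := norm_le_norm_sub_add _ _
    linarith
  · intro y hy
    rw [mem_ball_zero_iff] at hy
    have h0 : 0 ≤ M * |t| := by positivity
    have := key (-t) y (abs_neg t) (by linarith)
    refine ⟨T (-t) y, ?_, ?_⟩
    · rw [mem_ball_zero_iff]
      have h2 : ‖T (-t) y‖ ≤ ‖T (-t) y - y‖ + ‖y‖ := norm_le_norm_sub_add _ _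
      linarith
    · have := aux_unique hV (γ := fun s => T s (T (-t) y)) (δ := fun s => T (s - t) y)
        (fun s => hT.2 s _) (fun s => (hT.2 (s - t) y).comp_sub_const s t)
        (by simp [hT.1]) t
      simpa [hT.1] using this

lemma aux_restrict {α : Type*} [MeasurableSpace α] (μ : Measure α) [SFinite μ] {A U : Set α}
    (hU : MeasurableSet U) (h : A ⊆ U) :
    ∃ S, MeasurableSet S ∧ A ⊆ S ∧ S ⊆ U ∧ μ.restrict A = μ.restrict S := by
  refine ⟨toMeasurable μ A ∩ U, (measurableSet_toMeasurable _ _).inter hU,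
    Set.subset_inter (subset_toMeasurable _ _) h, Set.inter_subset_right, ?_⟩
  rw [Set.inter_comm, ← Measure.restrict_restrict hU, Measure.restrict_toMeasurable_of_sFinite,
    Measure.restrict_restrict hU, Set.inter_eq_right.2 h]

/-- The bilinear form with kernel `k`. -/
noncomputable def QF {n : ℕ} (k : EuclideanSpace ℝ (Fin n) → ℝ)
    (φ ψ : EuclideanSpace ℝ (Fin n) → ℝ) : ℝ :=
  ∫ p : EuclideanSpace ℝ (Fin n) × EuclideanSpace ℝ (Fin n),
    k (p.1 - p.2) * (φ p.1 * ψ p.2) ∂(volume.prod volume)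

section
variable {n : ℕ} {k : EuclideanSpace ℝ (Fin n) → ℝ} {φ ψ χ : EuclideanSpace ℝ (Fin n) → ℝ} {C : ℝ}

lemma QF_int (hk : Continuous k) (hC : ∀ x, |k x| ≤ C) (hφ : Integrable φ) (hψ : Integrable ψ) :
    Integrable (fun p : EuclideanSpace ℝ (Fin n) × EuclideanSpace ℝ (Fin n) =>
      k (p.1 - p.2) * (φ p.1 * ψ p.2)) (volume.prod volume) := by
  refine (hφ.mul_prod hψ).bdd_mul (c := C) ?_ (.of_forall fun p => hC _)
  exact (by fun_prop : Continuous fun p : EuclideanSpace ℝ (Fin n) × EuclideanSpace ℝ (Fin n) =>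
    k (p.1 - p.2)).aestronglyMeasurable

lemma QF_add_left (hk : Continuous k) (hC : ∀ x, |k x| ≤ C) (hφ : Integrable φ) (hψ : Integrable ψ)
    (hχ : Integrable χ) : QF k (φ + ψ) χ = QF k φ χ + QF k ψ χ := by
  unfold QF
  rw [← integral_add (QF_int hk hC hφ hχ) (QF_int hk hC hψ hχ)]
  congr 1; ext p; simp; ring

lemma QF_add_right (hk : Continuous k) (hC : ∀ x, |k x| ≤ C) (hφ : Integrable φ) (hψ : Integrable ψ)
    (hχ : Integrable χ) : QF k φ (ψ + χ) = QF k φ ψ + QF k φ χ := by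
  unfold QF
  rw [← integral_add (QF_int hk hC hφ hψ) (QF_int hk hC hφ hχ)]
  congr 1; ext p; simp; ring

lemma QF_smul_left (c : ℝ) : QF k (c • φ) ψ = c * QF k φ ψ := by
  unfold QF
  rw [← integral_const_mul]
  congr 1; ext p; simp; ring

lemma QF_smul_right (c : ℝ) : QF k φ (c • ψ) = c * QF k φ ψ := by
  unfold QF
  rw [← integral_const_mul]
  congr 1; ext p; simp; ring

lemma QF_bound (hC : ∀ x, |k x| ≤ C) (hφ : Integrable φ) (hψ : Integrable ψ) :
    |QF k φ ψ| ≤ C * ((∫ x, |φ x|) * ∫ x, |ψ x|) := by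
  unfold QF
  rw [← integral_prod_mul, ← integral_const_mul, ← Real.norm_eq_abs]
  refine norm_integral_le_of_norm_le ((hφ.abs.mul_prod hψ.abs).const_mul C) (.of_forall fun p => ?_)
  rw [norm_mul, norm_mul]
  simp only [Real.norm_eq_abs]
  gcongr
  exact hC _

lemma QF_iter (hk : Continuous k) (hC : ∀ x, |k x| ≤ C) (hφ : Integrable φ) (hψ : Integrable ψ) :
    QF k φ ψ = ∫ x, ∫ y, k (x - y) * (φ x * ψ y) :=
  integral_prod _ (QF_int hk hC hφ hψ)

lemma QF_symm (hk : ∀ x, k (-x) = k x) : QF k φ ψ = QF k ψ φ := by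
  unfold QF
  rw [← integral_prod_swap]
  congr 1; ext p
  simp only [Prod.fst_swap, Prod.snd_swap]
  rw [← hk, neg_sub, mul_comm (φ _)]

/-- Iterated integral over a set as a quadratic form of the indicator. -/
lemma QF_indicator (hk : Continuous k) (hC : ∀ x, |k x| ≤ C) {S : Set (EuclideanSpace ℝ (Fin n))}
    (hS : MeasurableSet S) (hS' : volume S ≠ ⊤) :
    ∫ x in S, ∫ y in S, k (x - y) = QF k (S.indicator 1) (S.indicator 1) := by
  have hi : Integrable (S.indicator (1 : EuclideanSpace ℝ (Fin n) → ℝ)) :=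
    (integrableOn_const hS').integrable_indicator hS
  rw [QF_iter hk hC hi hi, ← integral_indicator hS]
  congr 1; ext x
  by_cases hx : x ∈ S
  · rw [Set.indicator_of_mem hx, ← integral_indicator hS]
    congr 1; ext y
    by_cases hy : y ∈ S <;> simp [hx, hy]
  · simp [hx]

lemma QF_congr {g : EuclideanSpace ℝ (Fin n) → ℝ} {K : ℝ} (hg : ∀ x, ‖x‖ ≤ 2 * K → k x = g x)
    (hφ : ∀ x, K < ‖x‖ → φ x = 0) (hψ : ∀ x, K < ‖x‖ → ψ x = 0) (x y : EuclideanSpace ℝ (Fin n)) :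
    k (x - y) * (φ x * ψ y) = g (x - y) * (φ x * ψ y) := by
  by_cases hx : K < ‖x‖
  · simp [hφ x hx]
  by_cases hy : K < ‖y‖
  · simp [hψ y hy]
  rw [hg]
  push Not at hx hy
  linarith [norm_sub_le x y]

lemma QF_nonneg_smooth {g : EuclideanSpace ℝ (Fin n) → ℝ} {K : ℝ}
    (hgk : ∀ x, ‖x‖ ≤ 2 * K → k x = g x) (hg : IsPosDefRadialKernel g)
    (hk : Continuous k) (hC : ∀ x, |k x| ≤ C)
    (hφ0 : ∀ x, K < ‖x‖ → φ x = 0) (hφ : ContDiff ℝ (⊤ : ℕ∞) φ) (hc : HasCompactSupport φ) :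
    0 ≤ QF k φ φ := by
  have hi : Integrable φ := hφ.continuous.integrable_of_hasCompactSupport hc
  have := (hg.2.2 (fun x => (φ x : ℂ)) (Complex.ofRealCLM.contDiff.comp hφ)
    (hc.comp_left Complex.ofReal_zero)).2
  rw [QF_iter hk hC hi hi]
  simp only [QF_congr hgk hφ0 hφ0]
  convert this
  simp only [Complex.conj_ofReal, ← Complex.ofReal_mul, integral_complex_ofReal, Complex.ofReal_re,
    mul_assoc]

lemma QF_nonneg {g : EuclideanSpace ℝ (Fin n) → ℝ} {K : ℝ} (hK : 0 < K)
    (hgk : ∀ x, ‖x‖ ≤ 2 * (K + 1) → k x = g x) (hg : IsPosDefRadialKernel g)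
    (hk : Continuous k) (hC : ∀ x, |k x| ≤ C)
    (hφ0 : ∀ x, K < ‖x‖ → φ x = 0) (hφ : Integrable φ) :
    0 ≤ QF k φ φ := by
  set N := ∫ x, |φ x| with hN
  have hC0 : 0 ≤ C := (abs_nonneg _).trans (hC 0)
  have key : ∀ ε : ℝ, 0 < ε → - (C * (ε * (2 * N + ε))) ≤ QF k φ φ := by
    intro ε hε
    obtain ⟨ψ₀, hc₀, hs₀, hψ₀⟩ := MemLp.exist_eLpNorm_sub_le (p := 1) (by simp) le_rfl
      (memLp_one_iff_integrable.2 hφ) hε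
    let b : ContDiffBump (0 : EuclideanSpace ℝ (Fin n)) := ⟨K, K + 1, hK, by linarith⟩
    set ψ : EuclideanSpace ℝ (Fin n) → ℝ := fun x => b x * ψ₀ x with hψ
    have hs : ContDiff ℝ (⊤ : ℕ∞) ψ := b.contDiff.mul hs₀
    have hc : HasCompactSupport ψ := hc₀.mul_left
    have hi : Integrable ψ := hs.continuous.integrable_of_hasCompactSupport hc
    have hi₀ : Integrable ψ₀ := hs₀.continuous.integrable_of_hasCompactSupport hc₀
    have hψ0 : ∀ x, K + 1 < ‖x‖ → ψ x = 0 := by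
      intro x hx
      have : b x = 0 := b.zero_of_le_dist (by simpa [b] using hx.le)
      simp [hψ, this]
    have h1 : ∫ x, |(φ - ψ₀) x| ≤ ε := by
      have h := hφ.sub hi₀
      rw [eLpNorm_one_eq_lintegral_enorm, ← ofReal_integral_norm_eq_lintegral_enorm h,
        ENNReal.ofReal_le_ofReal_iff hε.le] at hψ₀
      exact hψ₀
    have h2 : ∫ x, |(φ - ψ) x| ≤ ε := by
      refine (integral_mono (hφ.sub hi).abs (hφ.sub hi₀).abs fun x => ?_).trans h1
      have hb : φ x - ψ x = b x * (φ x - ψ₀ x) := by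
        by_cases hx : K < ‖x‖
        · simp [hψ, hφ0 x hx]
        · have : b x = 1 := b.one_of_mem_closedBall (by simpa [b] using hx)
          simp [hψ, this]
      simp only [Pi.sub_apply]
      rw [hb, abs_mul, abs_of_nonneg b.nonneg]
      exact mul_le_of_le_one_left (abs_nonneg _) b.le_one
    have h3 : ∫ x, |ψ x| ≤ N + ε := by
      have : ∫ x, |ψ x| ≤ ∫ x, (|φ x| + |(φ - ψ) x|) := by
        refine integral_mono hi.abs (hφ.abs.add (hφ.sub hi).abs) fun x => ?_
        have := abs_sub (φ x) (φ x - ψ x)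
        simpa using this
      rw [integral_add hφ.abs (hφ.sub hi).abs] at this
      linarith
    have h4 := QF_nonneg_smooth hgk hg hk hC hψ0 hs hc
    have h5 : QF k φ φ = QF k ψ ψ + QF k ψ (φ - ψ) + QF k (φ - ψ) φ := by
      rw [← QF_add_right hk hC hi hi (hφ.sub hi), add_sub_cancel,
        ← QF_add_left hk hC hi (hφ.sub hi) hφ, add_sub_cancel]
    have h6 := (abs_le.1 (QF_bound hC hi (hφ.sub hi))).1
    have h7 := (abs_le.1 (QF_bound hC (hφ.sub hi) hφ)).1
    have n1 : 0 ≤ ∫ x, |(φ - ψ) x| := integral_nonneg fun x => abs_nonneg _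
    have n2 : 0 ≤ ∫ x, |ψ x| := integral_nonneg fun x => abs_nonneg _
    have n3 : 0 ≤ N := integral_nonneg fun x => abs_nonneg _
    have h8 : C * ((∫ x, |ψ x|) * ∫ x, |(φ - ψ) x|) ≤ C * ((N + ε) * ε) := by gcongr
    have h9 : C * ((∫ x, |(φ - ψ) x|) * ∫ x, |φ x|) ≤ C * (ε * N) := by gcongr
    linarith
  have lim : Filter.Tendsto (fun ε : ℝ => - (C * (ε * (2 * N + ε)))) (nhdsWithin 0 (Set.Ioi 0))
      (nhds 0) := by
    have : Continuous (fun ε : ℝ => - (C * (ε * (2 * N + ε)))) := by fun_prop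
    simpa using (this.tendsto 0).mono_left nhdsWithin_le_nhds
  exact le_of_tendsto lim (Filter.eventually_of_mem self_mem_nhdsWithin key)

end

lemma aux_main {n : ℕ} {g : EuclideanSpace ℝ (Fin n) → ℝ}
    (hg : IsPosDefRadialKernel g) {R : ℝ} (hR : 0 < R)
    (hFB : (∫ x in ball (0 : EuclideanSpace ℝ (Fin n)) R,
        ∫ y in ball (0 : EuclideanSpace ℝ (Fin n)) R, g (x - y)) = 0) :
    ∃ C : ℝ, ∀ S : Set (EuclideanSpace ℝ (Fin n)), MeasurableSet S → S ⊆ ball 0 (R + 1) →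
      |∫ x in S, ∫ y in S, g (x - y)| ≤
        C * (∫ x, |(S.indicator 1 - (ball 0 R).indicator 1 : EuclideanSpace ℝ (Fin n) → ℝ) x|) ^ 2 := by
  obtain ⟨C, hC⟩ := (isCompact_closedBall (0 : EuclideanSpace ℝ (Fin n))
    (2 * (R + 1 + 1))).exists_bound_of_continuousOn hg.1.continuousOn
  have hC0 : 0 ≤ C := (norm_nonneg _).trans (hC 0 (by simp; linarith))
  set k : EuclideanSpace ℝ (Fin n) → ℝ := fun x => max (-C) (min C (g x)) with hk
  have kc : Continuous k := by have := hg.1; fun_prop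
  have kC : ∀ x, |k x| ≤ C := fun x =>
    abs_le.2 ⟨le_max_left _ _, max_le (by linarith) (min_le_left _ _)⟩
  have kg : ∀ x, ‖x‖ ≤ 2 * (R + 1 + 1) → k x = g x := by
    intro x hx
    have := abs_le.1 (hC x (by simpa using hx))
    simp only [hk]
    rw [min_eq_right this.2, max_eq_right this.1]
  have ksymm : ∀ x, k (-x) = k x := by
    intro x
    simp only [hk, hg.2.1 (-x) x (norm_neg x)]
  have fin : ∀ S : Set (EuclideanSpace ℝ (Fin n)), S ⊆ ball 0 (R + 1) → volume S ≠ ⊤ :=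
    fun S h => ((measure_mono h).trans_lt measure_ball_lt_top).ne
  have trans : ∀ S : Set (EuclideanSpace ℝ (Fin n)), MeasurableSet S → S ⊆ ball 0 (R + 1) →
      ∫ x in S, ∫ y in S, g (x - y) = QF k (S.indicator 1) (S.indicator 1) := by
    intro S hS hSR
    rw [← QF_indicator kc kC hS (fin S hSR)]
    refine setIntegral_congr_fun hS fun x hx => setIntegral_congr_fun hS fun y hy => ?_
    have h1 := hSR hx
    have h2 := hSR hy
    rw [mem_ball_zero_iff] at h1 h2
    exact (kg _ (by linarith [norm_sub_le x y])).symm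
  have int : ∀ S : Set (EuclideanSpace ℝ (Fin n)), MeasurableSet S → S ⊆ ball 0 (R + 1) →
      Integrable (S.indicator (1 : EuclideanSpace ℝ (Fin n) → ℝ)) := by
    intro S hS hSR
    exact (integrableOn_const (fin S hSR)).integrable_indicator hS
  have van : ∀ S : Set (EuclideanSpace ℝ (Fin n)), S ⊆ ball 0 (R + 1) → ∀ x, R + 1 < ‖x‖ →
      S.indicator (1 : EuclideanSpace ℝ (Fin n) → ℝ) x = 0 := by
    intro S hSR x hx
    refine Set.indicator_of_notMem (fun h => ?_) _
    have := hSR h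
    rw [mem_ball_zero_iff] at this
    linarith
  have hBR : ball (0 : EuclideanSpace ℝ (Fin n)) R ⊆ ball 0 (R + 1) :=
    ball_subset_ball (by linarith)
  refine ⟨C, fun S hS hSR => ?_⟩
  rw [trans S hS hSR]
  rw [trans _ measurableSet_ball hBR] at hFB
  have iB := int _ measurableSet_ball hBR
  have iS := int S hS hSR
  have vB := van _ hBR
  have vS := van S hSR
  generalize (ball (0 : EuclideanSpace ℝ (Fin n)) R).indicator
    (1 : EuclideanSpace ℝ (Fin n) → ℝ) = b at *
  generalize S.indicator (1 : EuclideanSpace ℝ (Fin n) → ℝ) = s at *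
  have ih := iS.sub iB
  have expand : ∀ c : ℝ, QF k (b + c • (s - b)) (b + c • (s - b)) =
      2 * c * QF k b (s - b) + c ^ 2 * QF k (s - b) (s - b) := by
    intro c
    have ic : Integrable (c • (s - b)) := ih.smul c
    rw [QF_add_left kc kC iB ic (iB.add ic), QF_add_right kc kC iB iB ic,
      QF_add_right kc kC ic iB ic, QF_smul_left, QF_smul_left, QF_smul_right, QF_smul_right, hFB,
      QF_symm ksymm (φ := s - b) (ψ := b)]
    ring
  have nn : ∀ c : ℝ, 0 ≤ 2 * c * QF k b (s - b) + c ^ 2 * QF k (s - b) (s - b) := by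
    intro c
    rw [← expand]
    refine QF_nonneg (K := R + 1) (by linarith) kg hg kc kC ?_ (iB.add (ih.smul c))
    intro x hx
    simp [vB x hx, vS x hx]
  have zero : QF k b (s - b) = 0 := by
    generalize QF k b (s - b) = p at *
    generalize QF k (s - b) (s - b) = q at *
    have h1 := nn 1
    have hq : 0 ≤ q := by have := nn (-1); linarith
    have h3 := nn (-p / (q + 1))
    have h4 : 2 * (-p / (q + 1)) * p + (-p / (q + 1)) ^ 2 * q = -(p ^ 2 * (q + 2) / (q + 1) ^ 2) := by
      field_simp
      ring
    rw [h4] at h3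
    by_contra hp
    have : 0 < p ^ 2 * (q + 2) / (q + 1) ^ 2 := by positivity
    linarith
  have e1 := expand 1
  rw [zero] at e1
  simp only [one_smul, add_sub_cancel] at e1
  rw [e1]
  have := QF_bound kC ih ih
  simpa [sq] using this

lemma aux_meas {n : ℕ} {R r₁ r₂ : ℝ} (h0 : 0 < r₁) (h1 : r₁ ≤ R) (h2 : R ≤ r₂)
    {S : Set (EuclideanSpace ℝ (Fin n))} (hS : MeasurableSet S)
    (hS₁ : ball 0 r₁ ⊆ S) (hS₂ : S ⊆ ball 0 r₂) :
    ∫ x, |(S.indicator 1 - (ball 0 R).indicator 1 : EuclideanSpace ℝ (Fin n) → ℝ) x| ≤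
      (r₂ ^ n - r₁ ^ n) * volume.real (ball (0 : EuclideanSpace ℝ (Fin n)) 1) := by
  have hm : ∀ r, 0 < r → volume.real (ball (0 : EuclideanSpace ℝ (Fin n)) r) =
      r ^ n * volume.real (ball (0 : EuclideanSpace ℝ (Fin n)) 1) := by
    intro r hr
    rw [measureReal_def, Measure.addHaar_ball_of_pos _ _ hr, ENNReal.toReal_mul,
      ENNReal.toReal_ofReal (by positivity), finrank_euclideanSpace_fin, measureReal_def]
  have int : ∀ S : Set (EuclideanSpace ℝ (Fin n)), MeasurableSet S → S ⊆ ball 0 r₂ →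
      Integrable (S.indicator (1 : EuclideanSpace ℝ (Fin n) → ℝ)) := by
    intro S hS hSR
    exact (integrableOn_const ((measure_mono hSR).trans_lt
      measure_ball_lt_top).ne).integrable_indicator hS
  have i1 := int (ball 0 r₁) measurableSet_ball (ball_subset_ball (h1.trans h2))
  have i2 := int (ball 0 r₂) measurableSet_ball subset_rfl
  have i3 := int (ball 0 R) measurableSet_ball (ball_subset_ball h2)
  rw [sub_mul, ← hm _ (by linarith), ← hm _ h0, ← integral_indicator_one measurableSet_ball,
    ← integral_indicator_one measurableSet_ball, ← integral_sub i2 i1]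
  refine integral_mono ((int S hS hS₂).sub i3).abs (i2.sub i1) fun x => ?_
  have a1 : ∀ {U W : Set (EuclideanSpace ℝ (Fin n))}, U ⊆ W →
      U.indicator (1 : EuclideanSpace ℝ (Fin n) → ℝ) x ≤ W.indicator 1 x := fun h =>
    Set.indicator_le_indicator_of_subset h (fun _ => zero_le_one) x
  have b1 := a1 hS₁
  have b2 := a1 hS₂
  have b3 := a1 (ball_subset_ball (x := (0 : EuclideanSpace ℝ (Fin n))) h1)
  have b4 := a1 (ball_subset_ball (x := (0 : EuclideanSpace ℝ (Fin n))) h2)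
  simp only [Pi.sub_apply]
  rw [abs_le]
  constructor <;> linarith

theorem stmt_13 {n : ℕ} (hn : 2 ≤ n) (g : EuclideanSpace ℝ (Fin n) → ℝ)
    (hg : IsPosDefRadialKernel g) (hg1 : ContDiff ℝ 1 g) (R : ℝ) (hR : 0 < R)
    (hFB : (∫ x in ball (0 : EuclideanSpace ℝ (Fin n)) R,
        ∫ y in ball (0 : EuclideanSpace ℝ (Fin n)) R, g (x - y)) = 0)
    (V : EuclideanSpace ℝ (Fin n) → EuclideanSpace ℝ (Fin n))
    (T : ℝ → EuclideanSpace ℝ (Fin n) → EuclideanSpace ℝ (Fin n))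
    (hV : ContDiff ℝ 1 V) (hT : IsGlobalFlow V T) :
    HasDerivAt
      (fun t : ℝ => ∫ x in T t '' ball (0 : EuclideanSpace ℝ (Fin n)) R,
        ∫ y in T t '' ball (0 : EuclideanSpace ℝ (Fin n)) R, g (x - y)) 0 0 := by
  have hF0 := hFB
  obtain ⟨C, hC⟩ := aux_main hg hR hFB
  obtain ⟨M, hM, hflow⟩ := aux_flow hV hT R
  set v := volume.real (ball (0 : EuclideanSpace ℝ (Fin n)) 1) with hv
  have hC' : ∀ t : ℝ, M * |t| < min 1 R →
      |∫ x in T t '' ball (0 : EuclideanSpace ℝ (Fin n)) R,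
        ∫ y in T t '' ball (0 : EuclideanSpace ℝ (Fin n)) R, g (x - y)| ≤
        |C| * (((R + M * |t|) ^ n - (R - M * |t|) ^ n) * v) ^ 2 := by
    intro t ht
    have ht1 : M * |t| < 1 := ht.trans_le (min_le_left _ _)
    have htR : M * |t| < R := ht.trans_le (min_le_right _ _)
    have h0 : 0 ≤ M * |t| := by positivity
    obtain ⟨f1, f2⟩ := hflow t ht1.le
    obtain ⟨S, hS, s1, s2, s3⟩ := aux_restrict volume measurableSet_ball f1
    rw [s3]
    refine (hC S hS (s2.trans (ball_subset_ball (by linarith)))).trans ?_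
    have h1 := aux_meas (R := R) (by linarith : 0 < R - M * |t|) (by linarith)
      (by linarith : R ≤ R + M * |t|) hS (f2.trans s1) s2
    have h2 : 0 ≤ ∫ x, |(S.indicator 1 - (ball 0 R).indicator 1 :
      EuclideanSpace ℝ (Fin n) → ℝ) x| := integral_nonneg fun x => abs_nonneg _
    gcongr
    exact le_abs_self C
  have hd : (fun t : ℝ => (R + M * |t|) ^ n - (R - M * |t|) ^ n) =O[nhds 0] fun t => t := by
    have hd0 : DifferentiableAt ℝ (fun s : ℝ => (R + M * s) ^ n - (R - M * s) ^ n) 0 := by fun_prop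
    have h1 := hd0.isBigO_sub
    simp only [mul_zero, add_zero, sub_zero, sub_self] at h1
    have h2 : Filter.Tendsto (fun t : ℝ => |t|) (nhds 0) (nhds 0) := by
      simpa using (continuous_abs (G := ℝ)).tendsto 0
    have h3 := h1.comp_tendsto h2
    exact h3.trans (Asymptotics.isBigO_of_le _ fun t => by simp)
  have hsmall : ∀ᶠ t : ℝ in nhds 0, M * |t| < min 1 R := by
    have hc : Continuous fun t : ℝ => M * |t| := by fun_prop
    exact (hc.tendsto 0).eventually_lt_const (by simpa using hR)
  rw [hasDerivAt_iff_isLittleO]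
  have e0 : T 0 '' ball (0 : EuclideanSpace ℝ (Fin n)) R = ball 0 R := by
    have : T 0 = id := funext hT.1
    rw [this, Set.image_id]
  simp only [e0, hF0, sub_zero, smul_zero]
  have hO : (fun t : ℝ => ∫ x in T t '' ball (0 : EuclideanSpace ℝ (Fin n)) R,
        ∫ y in T t '' ball (0 : EuclideanSpace ℝ (Fin n)) R, g (x - y)) =O[nhds 0]
      fun t => t ^ 2 := by
    have h1 : (fun t : ℝ => |C| * (((R + M * |t|) ^ n - (R - M * |t|) ^ n) * v) ^ 2) =O[nhds 0]
        fun t => t ^ 2 := by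
      have h2 : (fun t : ℝ => ((R + M * |t|) ^ n - (R - M * |t|) ^ n) * v) =O[nhds 0]
          fun t => t := by
        simpa only [mul_comm] using hd.const_mul_left v
      exact (h2.pow 2).const_mul_left _
    refine Asymptotics.IsBigO.trans (Asymptotics.IsBigO.of_bound 1 ?_) h1
    filter_upwards [hsmall] with t ht
    rw [one_mul, Real.norm_eq_abs, Real.norm_eq_abs]
    exact (hC' t ht).trans (le_abs_self _)
  refine hO.trans_isLittleO ?_
  simpa using Asymptotics.isLittleO_pow_pow (𝕜 := ℝ) (m := 1) (n := 2) (by norm_num)
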